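/- The game Take with move vector S = (b₁,…,b_n) is a Nimdi game (i.e., the Sprague–Grundy value of every position (a₁,…,a_n) equals the Nim-sum a₁ ⊕ … ⊕ a_n, exactly as in Nim) if and only if S is odd, that is, if and only if (b₁ + … + b_n)/2^m is an odd integer, where m is the largest natural number such that 2^m divides every b_i. -/

import Mathlib

/-- The minimum excludant of a set of natural numbers. -/
noncomputable def mex (S : Set ℕ) : ℕ := sInf {n | n ∉ S}

/-- A move in the game Take with move vector `b`: either remove a positive number of
tokens from a single pile, or (when possible) remove `b i` tokens from pile `i`
for every `i` simultaneously. -/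
def TakeMove {n : ℕ} (b : Fin n → ℕ) (a c : Fin n → ℕ) : Prop :=
  (∃ j m, 1 ≤ m ∧ m ≤ a j ∧ c = Function.update a j (a j - m)) ∨
  ((∀ i, b i ≤ a i) ∧ c = fun i => a i - b i)

theorem mex_notMem {S : Set ℕ} (hS : S.Finite) : mex S ∉ S :=
  Nat.sInf_mem (s := {n | n ∉ S}) hS.infinite_compl.nonempty

theorem mex_eq_of_forall_lt {S : Set ℕ} {v : ℕ} (hv : v ∉ S) (h : ∀ w < v, w ∈ S) :
    mex S = v := by
  refine le_antisymm (Nat.sInf_le hv) (le_csInf ⟨v, hv⟩ fun w hw => ?_)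
  by_contra! hlt
  exact hw (h w hlt)

/-- The bitwise exclusive or of the entries of a tuple. -/
def nimSum {n : ℕ} (a : Fin n → ℕ) : ℕ := (List.ofFn fun i => a i).foldr (· ^^^ ·) 0

theorem nimSum_succ {n : ℕ} (a : Fin (n + 1) → ℕ) :
    nimSum a = a 0 ^^^ nimSum (fun i => a i.succ) := by
  simp [nimSum, List.ofFn_succ]

theorem testBit_nimSum {n : ℕ} (a : Fin n → ℕ) (k : ℕ) :
    (nimSum a).testBit k = decide ((∑ i, a i / 2 ^ k) % 2 = 1) := by
  induction n with
  | zero => simp [nimSum]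
  | succ n ih =>
    rw [nimSum_succ, Nat.testBit_xor, ih, Fin.sum_univ_succ, Nat.testBit_eq_decide_div_mod_eq,
      Bool.eq_iff_iff]
    simp only [bne_iff_ne, ne_eq, decide_eq_decide, decide_eq_true_eq]
    omega

theorem nimSum_update_xor {n : ℕ} (a : Fin n → ℕ) (j : Fin n) (w : ℕ) :
    nimSum (Function.update a j w) = nimSum a ^^^ a j ^^^ w := by
  induction n with
  | zero => exact j.elim0
  | succ n ih =>
    rw [nimSum_succ, nimSum_succ a]
    refine Fin.cases ?_ (fun i => ?_) j
    · have h : (fun i : Fin n => Function.update a 0 w i.succ) = fun i => a i.succ := by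
        ext i; simp
      rw [h, Function.update_self, Nat.xor_comm (a 0), Nat.xor_xor_cancel_right, Nat.xor_comm]
    · have h : (fun k : Fin n => Function.update a i.succ w k.succ) =
          Function.update (fun k => a k.succ) i w := by
        ext k; simp [Function.update_apply]
      rw [h, ih, Function.update_of_ne (Fin.succ_ne_zero i).symm]
      simp only [Nat.xor_assoc]

theorem exists_lt_of_lt_nimSum {n : ℕ} (a : Fin n → ℕ) (v : ℕ) (hv : v < nimSum a) :
    ∃ j, nimSum a ^^^ a j ^^^ v < a j := by
  induction n generalizing v with
  | zero => simp [nimSum] at hv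
  | succ n ih =>
    rw [nimSum_succ] at hv ⊢
    rcases Nat.lt_xor_cases hv with h | h
    · refine ⟨0, ?_⟩
      rwa [Nat.xor_comm (a 0), Nat.xor_xor_cancel_right, Nat.xor_comm]
    · obtain ⟨j, hj⟩ := ih _ _ h
      refine ⟨j.succ, ?_⟩
      convert hj using 1
      ac_rfl

theorem TakeMove.le {n : ℕ} {b a c : Fin n → ℕ} (h : TakeMove b a c) : c ≤ a := by
  rcases h with ⟨j, m, -, -, rfl⟩ | ⟨-, rfl⟩
  · exact update_le_self_iff.2 (Nat.sub_le _ _)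
  · exact fun i => Nat.sub_le _ _

theorem finite_setOf_takeMove {n : ℕ} (b a : Fin n → ℕ) : {c | TakeMove b a c}.Finite :=
  (Set.finite_Iic a).subset fun _ h => h.le

theorem TakeMove.sum_lt {n : ℕ} {b a c : Fin n → ℕ} (hb : 0 < ∑ i, b i) (h : TakeMove b a c) :
    ∑ i, c i < ∑ i, a i := by
  refine (Finset.sum_le_sum fun i _ => h.le i).lt_of_ne fun heq => ?_
  have hc := (Finset.sum_eq_sum_iff_of_le fun i _ => h.le i).1 heq
  rcases h with ⟨j, m, hm, hma, rfl⟩ | ⟨hle, rfl⟩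
  · have := hc j (Finset.mem_univ j)
    rw [Function.update_self] at this
    omega
  · refine hb.ne' (Finset.sum_eq_zero fun i hi => ?_)
    have h₁ := hc i hi
    have h₂ := hle i
    simp only at h₁
    omega

/-- If no move changes a position into one of the same nim-sum, then the game is Nimdi. -/
theorem eq_nimSum_of_takeMove_ne {n : ℕ} {b : Fin n → ℕ} (hb : 0 < ∑ i, b i)
    {G : (Fin n → ℕ) → ℕ} (hG : ∀ a, G a = mex (G '' {c | TakeMove b a c}))
    (hne : ∀ a, (∀ i, b i ≤ a i) → nimSum (fun i => a i - b i) ≠ nimSum a) (a : Fin n → ℕ) :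
    G a = nimSum a := by
  induction hs : ∑ i, a i using Nat.strong_induction_on generalizing a with
  | _ s ih =>
    subst hs
    have ih' : ∀ c, TakeMove b a c → G c = nimSum c := fun c hc => ih _ (hc.sum_lt hb) c rfl
    rw [hG]
    apply mex_eq_of_forall_lt
    · rintro ⟨c, hc, hGc⟩
      rw [ih' c hc] at hGc
      rcases hc with ⟨j, m, hm, hma, rfl⟩ | ⟨hle, rfl⟩
      · rw [nimSum_update_xor, Nat.xor_assoc] at hGc
        have := Nat.xor_eq_zero_iff.1 (Nat.xor_right_injective (hGc.trans (Nat.xor_zero _).symm))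
        omega
      · exact hne a hle hGc
    · intro v hv
      obtain ⟨j, hj⟩ := exists_lt_of_lt_nimSum a v hv
      have hmove : TakeMove b a (Function.update a j (nimSum a ^^^ a j ^^^ v)) :=
        .inl ⟨j, a j - (nimSum a ^^^ a j ^^^ v), by omega, by omega, by congr 1; omega⟩
      refine ⟨_, hmove, ?_⟩
      rw [ih' _ hmove, nimSum_update_xor, ← Nat.xor_assoc, Nat.xor_self, Nat.zero_xor]

theorem nimSum_sub_ne_of_odd {n m : ℕ} {b : Fin n → ℕ} (hm : ∀ i, 2 ^ m ∣ b i)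
    (hodd : Odd (∑ i, b i / 2 ^ m)) (a : Fin n → ℕ) (hle : ∀ i, b i ≤ a i) :
    nimSum (fun i => a i - b i) ≠ nimSum a := by
  intro h
  have hbit := congrArg (fun x => x.testBit m) h
  simp only [testBit_nimSum, decide_eq_decide] at hbit
  have hsum : ∑ i, a i / 2 ^ m = ∑ i, (a i - b i) / 2 ^ m + ∑ i, b i / 2 ^ m := by
    rw [← Finset.sum_add_distrib]
    refine Finset.sum_congr rfl fun i _ => ?_
    rw [← Nat.add_div_of_dvd_left (hm i), Nat.sub_add_cancel (hle i)]
  rw [Nat.odd_iff] at hodd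
  omega

/-- The integer tuple `d` is the difference of two tuples of natural numbers whose binary
expansions have, at every place, the same parity of ones. -/
def IsNimNeutral {ι : Type*} [Fintype ι] (d : ι → ℤ) : Prop :=
  ∃ x y : ι → ℕ, (∀ i, (y i : ℤ) = x i + d i) ∧
    ∀ k, (∑ i, x i / 2 ^ k) % 2 = (∑ i, y i / 2 ^ k) % 2

section IsNimNeutral

variable {ι : Type*} [Fintype ι]

theorem IsNimNeutral.zero : IsNimNeutral (0 : ι → ℤ) := ⟨0, 0, by simp, by simp⟩

theorem IsNimNeutral.of_two_mul_add {d e : ι → ℤ} (h : IsNimNeutral e)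
    (hde : ∀ i, |d i - 2 * e i| ≤ 1) (heven : Even (∑ i, d i)) : IsNimNeutral d := by
  obtain ⟨x, y, hxy, hpar⟩ := h
  refine ⟨fun i => 2 * x i + (2 * e i - d i).toNat, fun i => 2 * y i + (d i - 2 * e i).toNat,
    fun i => ?_, fun k => ?_⟩
  · have := hxy i
    push_cast
    omega
  · cases k with
    | zero =>
      have hsum : (∑ i, ((2 * y i + (d i - 2 * e i).toNat : ℕ) : ℤ)) =
          (∑ i, ((2 * x i + (2 * e i - d i).toNat : ℕ) : ℤ)) + ∑ i, d i := by
        rw [← Finset.sum_add_distrib]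
        refine Finset.sum_congr rfl fun i _ => ?_
        have := hxy i
        push_cast
        omega
      rw [← Nat.cast_sum, ← Nat.cast_sum] at hsum
      obtain ⟨r, hr⟩ := heven
      simp only [pow_zero, Nat.div_one]
      omega
    | succ k =>
      simp only [pow_succ', ← Nat.div_div_eq_div_mul]
      convert hpar k using 5 with i _ i
      all_goals
        have := abs_le.1 (hde i)
        omega

theorem exists_odd_of_even_sum {d : ι → ℤ} (heven : Even (∑ i, d i)) {i₀ : ι}
    (h₀ : Odd (d i₀)) : ∃ i₁, i₁ ≠ i₀ ∧ Odd (d i₁) := by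
  classical
  by_contra! h
  rw [← Finset.add_sum_erase _ _ (Finset.mem_univ i₀)] at heven
  have : Even (∑ i ∈ Finset.univ.erase i₀, d i) :=
    Finset.even_sum _ fun i hi => Int.not_odd_iff_even.1 (h i (Finset.ne_of_mem_erase hi))
  exact Int.not_even_iff_odd.2 (h₀.add_even this) heven

/-- A tuple of even sum with an odd entry can be halved, rounding odd entries either way, so that
the result has the same property. -/
theorem exists_half_of_even_sum {d : ι → ℤ} (heven : Even (∑ i, d i)) (hodd : ∃ i, Odd (d i)) :
    ∃ e : ι → ℤ, (∀ i, |d i - 2 * e i| ≤ 1) ∧ Even (∑ i, e i) ∧ ∃ i, Odd (e i) := by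
  classical
  obtain ⟨i₀, h₀⟩ := hodd
  obtain ⟨i₁, hne, h₁⟩ := exists_odd_of_even_sum heven h₀
  set s := 1 - d i₀ / 2 % 2 with hs
  set t := (∑ i, d i / 2 + s) % 2 with ht
  refine ⟨fun i => d i / 2 + ((Pi.single i₀ s : ι → ℤ) i + (Pi.single i₁ t : ι → ℤ) i),
    fun i => ?_, ?_, i₀, ?_⟩
  · rw [Int.odd_iff] at h₀ h₁
    rcases eq_or_ne i i₀ with rfl | hi₀
    · simp only [Pi.single_eq_same, Pi.single_eq_of_ne hne.symm]
      rw [abs_le]; omega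
    rcases eq_or_ne i i₁ with rfl | hi₁
    · simp only [Pi.single_eq_same, Pi.single_eq_of_ne hi₀]
      rw [abs_le]; omega
    · simp only [Pi.single_eq_of_ne hi₀, Pi.single_eq_of_ne hi₁]
      rw [abs_le]; omega
  · simp only [Finset.sum_add_distrib, Finset.sum_pi_single', Finset.mem_univ, if_true,
      Int.even_iff]
    omega
  · simp only [Pi.single_eq_same, Pi.single_eq_of_ne hne.symm, Int.odd_iff]
    omega

theorem isNimNeutral_of_even_sum {d : ι → ℤ} (heven : Even (∑ i, d i))
    (hodd : ∃ i, Odd (d i)) : IsNimNeutral d := by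
  induction hs : ∑ i, (d i).natAbs using Nat.strong_induction_on generalizing d with
  | _ s ih =>
    subst hs
    by_cases hsmall : ∀ i, |d i| ≤ 1
    · exact IsNimNeutral.zero.of_two_mul_add (by simpa using hsmall) heven
    · push Not at hsmall
      obtain ⟨j, hj⟩ := hsmall
      obtain ⟨e, hde, hesum, heodd⟩ := exists_half_of_even_sum heven hodd
      refine (ih _ (Finset.sum_lt_sum (fun i _ => ?_) ⟨j, Finset.mem_univ j, ?_⟩)
        hesum heodd rfl).of_two_mul_add hde heven
      · have := abs_le.1 (hde i)
        omega
      · have := abs_le.1 (hde j)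
        have := lt_abs.1 hj
        omega

theorem IsNimNeutral.two_pow_mul {d : ι → ℤ} (h : IsNimNeutral d) (m : ℕ) :
    IsNimNeutral fun i => 2 ^ m * d i := by
  induction m with
  | zero => simpa using h
  | succ m ih =>
    refine ih.of_two_mul_add (fun i => ?_) ?_
    · simp [pow_succ', mul_assoc]
    · exact Finset.even_sum _ fun i _ => by simp [pow_succ', mul_assoc]

end IsNimNeutral

theorem IsNimNeutral.exists_nimSum_add_eq {n : ℕ} {b : Fin n → ℕ}
    (h : IsNimNeutral fun i => (b i : ℤ)) :
    ∃ x : Fin n → ℕ, nimSum (fun i => x i + b i) = nimSum x := by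
  obtain ⟨x, y, hxy, hpar⟩ := h
  obtain rfl : y = fun i => x i + b i := funext fun i => Int.natCast_inj.1 (by simpa using hxy i)
  refine ⟨x, Nat.eq_of_testBit_eq fun k => ?_⟩
  rw [testBit_nimSum, testBit_nimSum, hpar k]

/-- Take with move vector `S = (b₁,…,b_n)` is a Nimdi game (every Sprague–Grundy
value equals the Nim-sum of the pile sizes, exactly as in Nim) if and only if `S`
is odd: `(b₁ + ⋯ + b_n)/2^m` is odd, where `m` is the largest natural number such
that `2^m` divides every `b i`. -/
theorem take_nimdi_iff_odd (n : ℕ) (hn : 0 < n) (b : Fin n → ℕ) (hb : 0 < ∑ i, b i)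
    (m : ℕ) (hm : ∀ i, 2 ^ m ∣ b i) (hm' : ¬ ∀ i, 2 ^ (m + 1) ∣ b i)
    (G : (Fin n → ℕ) → ℕ)
    (hG : ∀ a, G a = mex (G '' {c | TakeMove b a c})) :
    (∀ a : Fin n → ℕ, G a = (List.ofFn fun i => a i).foldr (· ^^^ ·) 0) ↔
      Odd ((∑ i, b i) / 2 ^ m) := by
  change (∀ a, G a = nimSum a) ↔ _
  have hdiv : (∑ i, b i) / 2 ^ m = ∑ i, b i / 2 ^ m := Nat.sum_div fun i _ => hm i
  rw [hdiv]
  refine ⟨fun h => ?_, fun h => eq_nimSum_of_takeMove_ne hb hG (nimSum_sub_ne_of_odd hm h)⟩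
  by_contra hnot
  rw [Nat.not_odd_iff_even] at hnot
  have hneutral : IsNimNeutral fun i => ((b i / 2 ^ m : ℕ) : ℤ) := by
    refine isNimNeutral_of_even_sum (by exact_mod_cast hnot) ?_
    by_contra! heven
    refine hm' fun i => ?_
    have hi := heven i
    rw [Int.not_odd_iff_even, Int.even_coe_nat] at hi
    rw [pow_succ]
    exact (Nat.dvd_div_iff_mul_dvd (hm i)).1 hi.two_dvd
  have hscale : (fun i => (2 : ℤ) ^ m * ((b i / 2 ^ m : ℕ) : ℤ)) = fun i => (b i : ℤ) :=
    funext fun i => by exact_mod_cast Nat.mul_div_cancel' (hm i)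
  obtain ⟨x, hx⟩ := (hscale ▸ hneutral.two_pow_mul m).exists_nimSum_add_eq
  refine mex_notMem ((finite_setOf_takeMove b fun i => x i + b i).image G) ?_
  rw [← hG]
  exact ⟨x, .inr ⟨fun i => Nat.le_add_left _ _, by simp⟩, by rw [h, h, hx]⟩
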